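/- arXiv:2007.07783 — 2 statements merged into one kernel-verified Lean document; each statement's English description precedes it below -/
import Mathlib

section
/- For every integer n ≥ 3, the integral J_L(n) = ∫_{0}^{1} t^{3/2} (1 − t)^{−1/2} [ ((1 + √(1 − t))/2)^{n−3} + ((1 − √(1 − t))/2)^{n−3} ] dt equals 32 · B(n − 1/2, 5/2), where B denotes the Euler Beta function. -/
open Real

/-- The Euler Beta function `B(a, b) = Γ(a)Γ(b)/Γ(a+b)`. -/
noncomputable def eulerBeta (a b : ℝ) : ℝ := Real.Gamma a * Real.Gamma b / Real.Gamma (a + b)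

lemma beta_real_aux (m : ℕ) :
    ∫ s in (0 : ℝ)..1, (s * (1 - s)) ^ (3 / 2 : ℝ) * s ^ m
      = eulerBeta ((m : ℝ) + 5 / 2) (5 / 2) := by
  have h := Complex.betaIntegral_eq_Gamma_mul_div (((m : ℝ) + 5 / 2 : ℝ) : ℂ) ((5 / 2 : ℝ) : ℂ)
    (by rw [Complex.ofReal_re]; positivity) (by rw [Complex.ofReal_re]; norm_num)
  rw [← Complex.ofReal_add, Complex.Gamma_ofReal, Complex.Gamma_ofReal, Complex.Gamma_ofReal,
    ← Complex.ofReal_mul, ← Complex.ofReal_div] at h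
  apply Complex.ofReal_injective
  rw [eulerBeta, ← h, ← intervalIntegral.integral_ofReal, Complex.betaIntegral]
  apply intervalIntegral.integral_congr_ae
  refine Filter.Eventually.of_forall fun s hs => ?_
  rw [Set.uIoc_of_le zero_le_one] at hs
  obtain ⟨h0, h1⟩ := hs
  have e1 : (((m : ℝ) + 5 / 2 : ℝ) : ℂ) - 1 = (((m : ℝ) + 3 / 2 : ℝ) : ℂ) := by
    push_cast; ring
  have e2 : ((5 / 2 : ℝ) : ℂ) - 1 = ((3 / 2 : ℝ) : ℂ) := by
    push_cast; ring
  have e3 : (1 : ℂ) - (s : ℂ) = ((1 - s : ℝ) : ℂ) := by push_cast; ring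
  rw [e1, e2, e3, ← Complex.ofReal_cpow h0.le, ← Complex.ofReal_cpow (by linarith),
    ← Complex.ofReal_mul]
  congr 1
  rw [Real.mul_rpow h0.le (by linarith), Real.rpow_add h0, Real.rpow_natCast]
  ring

/-- For `n ≥ 3`,
`J_L(n) = ∫₀¹ t^{3/2} (1−t)^{−1/2} [((1+√(1−t))/2)^{n−3} + ((1−√(1−t))/2)^{n−3}] dt
        = 32 · B(n − 1/2, 5/2)`. -/
theorem J_length_integral (n : ℕ) (hn : 3 ≤ n) :
    ∫ t in (0 : ℝ)..1, t ^ (3 / 2 : ℝ) * (1 - t) ^ (-(1 / 2) : ℝ) *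
        (((1 + Real.sqrt (1 - t)) / 2) ^ (n - 3) + ((1 - Real.sqrt (1 - t)) / 2) ^ (n - 3))
      = 32 * eulerBeta ((n : ℝ) - 1 / 2) (5 / 2) := by
  obtain ⟨m, rfl⟩ := Nat.exists_eq_add_of_le hn
  have e : ((3 + m : ℕ) : ℝ) - 1 / 2 = (m : ℝ) + 5 / 2 := by push_cast; ring
  rw [e, Nat.add_sub_cancel_left, ← beta_real_aux]
  set g : ℝ → ℝ := fun t => t ^ (3 / 2 : ℝ) * (1 - t) ^ (-(1 / 2) : ℝ) *
        (((1 + Real.sqrt (1 - t)) / 2) ^ m + ((1 - Real.sqrt (1 - t)) / 2) ^ m) with hg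
  set q : ℝ → ℝ := fun s => (s * (1 - s)) ^ (3 / 2 : ℝ) * s ^ m with hq
  have hqc : Continuous q := by
    refine Continuous.mul ?_ (by fun_prop)
    exact Continuous.rpow_const (by fun_prop) (fun _ => Or.inr (by norm_num))
  have key := intervalIntegral.integral_comp_mul_deriv_of_deriv_nonpos (a := 1) (b := 1 / 2)
    (f := fun s : ℝ => 4 * s * (1 - s)) (f' := fun s => 4 - 8 * s) (g := g)
    (by fun_prop)
    (fun x _ => by
      have h1 := ((hasDerivAt_id' x).const_mul 4).mul ((hasDerivAt_id' x).const_sub 1)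
      exact h1.congr_deriv (by ring))
    (fun x hx => by
      have := hx.1
      rw [min_eq_right (by norm_num)] at this
      linarith)
  norm_num at key
  have hcong : ∫ x in (1 : ℝ)..(1 / 2), g (4 * x * (1 - x)) * (4 - 8 * x)
      = ∫ x in (1 : ℝ)..(1 / 2), (-32) * (q x + q (1 - x)) := by
    apply intervalIntegral.integral_congr_ae
    refine Filter.Eventually.of_forall fun s hs => ?_
    rw [Set.uIoc_of_ge (by norm_num)] at hs
    obtain ⟨h0, h1⟩ := hs
    have hp : 0 < 2 * s - 1 := by linarith
    have es : 1 - 4 * s * (1 - s) = (2 * s - 1) ^ 2 := by ring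
    have e4 : (4 : ℝ) ^ (3 / 2 : ℝ) = 8 := by
      rw [show (4 : ℝ) = 2 ^ (2 : ℝ) by norm_num, ← Real.rpow_mul (by norm_num)]
      norm_num
    have ei : ((2 * s - 1) ^ 2) ^ (-(1 / 2) : ℝ) = (2 * s - 1)⁻¹ := by
      rw [Real.rpow_neg (by positivity), ← Real.sqrt_eq_rpow, Real.sqrt_sq hp.le]
    simp only [hg, hq]
    rw [es, ei, Real.sqrt_sq hp.le, mul_assoc 4 s (1 - s),
      Real.mul_rpow (by norm_num) (mul_nonneg (by linarith) (by linarith)), e4,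
      show (1 + (2 * s - 1)) / 2 = s by ring, show (1 - (2 * s - 1)) / 2 = 1 - s by ring,
      show (1 - s) * (1 - (1 - s)) = s * (1 - s) by ring,
      show 4 - 8 * s = -4 * (2 * s - 1) by ring]
    have hc := inv_mul_cancel₀ hp.ne'
    generalize (2 * s - 1)⁻¹ = w at hc ⊢
    generalize (s * (1 - s)) ^ (3 / 2 : ℝ) = z
    linear_combination (-32 * z * (s ^ m + (1 - s) ^ m)) * hc
  have i1 : ∫ x in (1 : ℝ)..(1 / 2), q (1 - x) = ∫ x in (1 / 2 : ℝ)..0, q x := by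
    rw [intervalIntegral.integral_comp_sub_left]
    norm_num
  have hqc' : Continuous fun x => q (1 - x) := by fun_prop
  rw [← key, hcong, intervalIntegral.integral_const_mul,
    intervalIntegral.integral_add (hqc.intervalIntegrable _ _) (hqc'.intervalIntegrable _ _), i1,
    intervalIntegral.integral_add_adjacent_intervals (hqc.intervalIntegrable _ _)
      (hqc.intervalIntegrable _ _), intervalIntegral.integral_symm]
  ring
end

section
/- For every real ρ > 0, the integral K_L(ρ) = ∫_{0}^{1} t^{3/2} (1 − t)^{−1/2} [ e^{−2πρ(1 + √(1 − t))} + e^{−2πρ(1 − √(1 − t))} ] dt equals (3/(2π)) · ρ^{−2} · e^{−2πρ} · I₂(2πρ), where I₂ denotes the modified Bessel function of the first kind of order 2. -/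
open Real

/-- The modified Bessel function of the first kind of order 2, defined by its power
series `I₂(x) = ∑_{j=0}^∞ (x/2)^{2j+2} / (j! (j+2)!)`. -/
noncomputable def besselI2 (x : ℝ) : ℝ :=
  ∑' j : ℕ, (x / 2) ^ (2 * j + 2) / ((j.factorial : ℝ) * ((j + 2).factorial : ℝ))

open MeasureTheory

lemma aux_cast (a b : ℝ) (x : ℝ) (hx : x ∈ Set.Ioc (0 : ℝ) 1) :
    ((x : ℂ) ^ ((a : ℂ) - 1) * (1 - (x : ℂ)) ^ ((b : ℂ) - 1)) =
      ((x ^ (a - 1) * (1 - x) ^ (b - 1) : ℝ) : ℂ) := by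
  rw [Complex.ofReal_mul, Complex.ofReal_cpow hx.1.le, Complex.ofReal_cpow (by linarith [hx.2])]
  push_cast
  rfl

lemma aux_int (a b : ℝ) (ha : 0 < a) (hb : 0 < b) :
    IntervalIntegrable (fun x : ℝ => x ^ (a - 1) * (1 - x) ^ (b - 1)) volume 0 1 := by
  have h := Complex.betaIntegral_convergent (u := a) (v := b) (by simpa) (by simpa)
  rw [intervalIntegrable_iff_integrableOn_Ioc_of_le zero_le_one] at h ⊢
  have h2 := h.re
  refine IntegrableOn.congr_fun h2 (fun x hx => ?_) measurableSet_Ioc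
  simp only [aux_cast a b x hx]
  simp

lemma aux_beta (a b : ℝ) (ha : 0 < a) (hb : 0 < b) :
    ∫ x in (0 : ℝ)..1, x ^ (a - 1) * (1 - x) ^ (b - 1) =
      Gamma a * Gamma b / Gamma (a + b) := by
  have h := Complex.betaIntegral_eq_Gamma_mul_div (u := a) (v := b) (by simpa) (by simpa)
  rw [Complex.betaIntegral, intervalIntegral.integral_of_le zero_le_one,
    setIntegral_congr_fun measurableSet_Ioc (fun x hx => aux_cast a b x hx),
    integral_complex_ofReal, ← Complex.ofReal_add, Complex.Gamma_ofReal, Complex.Gamma_ofReal,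
    Complex.Gamma_ofReal] at h
  rw [intervalIntegral.integral_of_le zero_le_one]
  exact_mod_cast h

lemma aux_gamma (n : ℕ) :
    Gamma ((n : ℝ) + 1 / 2) = (2 * n).factorial * √π / (4 ^ n * n.factorial) := by
  induction n with
  | zero => simp [-one_div, Gamma_one_half_eq]
  | succ k ih =>
    have : ((k + 1 : ℕ) : ℝ) + 1 / 2 = ((k : ℝ) + 1 / 2) + 1 := by push_cast; ring
    rw [this, Gamma_add_one (by positivity), ih]
    have h2 : 2 * (k + 1) = 2 * k + 1 + 1 := by ring
    rw [h2, Nat.factorial_succ, Nat.factorial_succ, Nat.factorial_succ]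
    push_cast
    field_simp
    ring

lemma aux_coef (n : ℕ) :
    Gamma (5 / 2) * Gamma ((n : ℝ) + 1 / 2) / Gamma (5 / 2 + ((n : ℝ) + 1 / 2)) =
      3 * π / 4 * ((2 * n).factorial / (4 ^ n * n.factorial * (n + 2).factorial)) := by
  have h1 : (5 / 2 : ℝ) = ((2 : ℕ) : ℝ) + 1 / 2 := by norm_num
  have h2 : (5 / 2 + ((n : ℝ) + 1 / 2)) = ((n + 2 : ℕ) : ℝ) + 1 := by push_cast; ring
  rw [h2, Gamma_nat_eq_factorial, h1, aux_gamma, aux_gamma]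
  have h3 : (2 * 2).factorial = 24 := rfl
  have h4 : √π ^ 2 = π := Real.sq_sqrt pi_pos.le
  rw [h3]
  simp only [Nat.factorial_two]
  push_cast
  field_simp
  rw [h4]
  ring

lemma aux_main (z : ℝ) (hz : 0 < z) :
    HasSum (fun n : ℕ => 2 * Real.exp (-z) * (z ^ (2 * n) / (2 * n).factorial) *
        (Gamma (5 / 2) * Gamma ((n : ℝ) + 1 / 2) / Gamma (5 / 2 + ((n : ℝ) + 1 / 2))))
      (∫ t in (0 : ℝ)..1, t ^ (3 / 2 : ℝ) * (1 - t) ^ (-(1 / 2) : ℝ) *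
        (Real.exp (-z * (1 + Real.sqrt (1 - t)))
          + Real.exp (-z * (1 - Real.sqrt (1 - t))))) := by
  have key := intervalIntegral.hasSum_integral_of_dominated_convergence (μ := volume)
    (a := 0) (b := 1)
    (F := fun (n : ℕ) (t : ℝ) => 2 * Real.exp (-z) * (z ^ (2 * n) / (2 * n).factorial) *
      (t ^ ((5 / 2 : ℝ) - 1) * (1 - t) ^ (((n : ℝ) + 1 / 2) - 1)))
    (f := fun t : ℝ => t ^ (3 / 2 : ℝ) * (1 - t) ^ (-(1 / 2) : ℝ) *
        (Real.exp (-z * (1 + Real.sqrt (1 - t)))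
          + Real.exp (-z * (1 - Real.sqrt (1 - t)))))
    (fun (n : ℕ) (t : ℝ) => (z ^ (2 * n) / (2 * n).factorial) * (2 * Real.exp (-z) *
      (t ^ ((5 / 2 : ℝ) - 1) * (1 - t) ^ ((1 / 2 : ℝ) - 1)))) ?_ ?_ ?_ ?_ ?_
  · simp only [intervalIntegral.integral_const_mul] at key
    have hb : ∀ n : ℕ, ∫ x in (0 : ℝ)..1, x ^ ((5 / 2 : ℝ) - 1) *
        (1 - x) ^ (((n : ℝ) + 1 / 2) - 1) = _ :=
      fun n => aux_beta (5 / 2) ((n : ℝ) + 1 / 2) (by norm_num) (by positivity)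
    simp only [hb] at key
    exact key
  · intro n
    exact (by fun_prop : Measurable _).aestronglyMeasurable
  · intro n
    have h1 : ∀ᵐ t : ℝ, t ≠ 1 := by simp [ae_iff]
    filter_upwards [h1] with t ht1 ht
    rw [Set.uIoc_of_le zero_le_one] at ht
    have h0 : 0 < 1 - t := by linarith [lt_of_le_of_ne ht.2 ht1]
    have ht0 := ht.1
    rw [Real.norm_of_nonneg (by positivity)]
    have : (1 - t) ^ (((n : ℝ) + 1 / 2) - 1) ≤ (1 - t) ^ ((1 / 2 : ℝ) - 1) :=
      Real.rpow_le_rpow_of_exponent_ge h0 (by linarith) (by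
        have : (0 : ℝ) ≤ n := n.cast_nonneg
        linarith)
    calc _ ≤ 2 * Real.exp (-z) * (z ^ (2 * n) / (2 * n).factorial) *
      (t ^ ((5 / 2 : ℝ) - 1) * (1 - t) ^ ((1 / 2 : ℝ) - 1)) := by gcongr
      _ = _ := by ring
  · exact Filter.Eventually.of_forall fun t _ => (Real.hasSum_cosh z).summable.mul_right _
  · simp only [tsum_mul_right]
    exact ((aux_int (5 / 2) (1 / 2) (by norm_num) (by norm_num)).const_mul _).const_mul _
  · have h1 : ∀ᵐ t : ℝ, t ≠ 1 := by simp [ae_iff]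
    filter_upwards [h1] with t ht1 ht
    rw [Set.uIoc_of_le zero_le_one] at ht
    have h0 : 0 < 1 - t := by linarith [lt_of_le_of_ne ht.2 ht1]
    have hc := (Real.hasSum_cosh (z * √(1 - t))).mul_left
      (2 * Real.exp (-z) * (t ^ (3 / 2 : ℝ) * (1 - t) ^ (-(1 / 2) : ℝ)))
    have hf : ∀ n : ℕ, 2 * Real.exp (-z) * (z ^ (2 * n) / (2 * n).factorial) *
        (t ^ ((5 / 2 : ℝ) - 1) * (1 - t) ^ (((n : ℝ) + 1 / 2) - 1)) =
        2 * Real.exp (-z) * (t ^ (3 / 2 : ℝ) * (1 - t) ^ (-(1 / 2) : ℝ)) *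
          ((z * √(1 - t)) ^ (2 * n) / (2 * n).factorial) := by
      intro n
      have e1 : (1 - t) ^ (((n : ℝ) + 1 / 2) - 1) = (1 - t) ^ (-(1 / 2) : ℝ) * (1 - t) ^ n := by
        rw [← Real.rpow_natCast, ← Real.rpow_add h0]
        congr 1
        ring
      have e2 : (5 / 2 : ℝ) - 1 = 3 / 2 := by norm_num
      rw [e1, e2, mul_pow, pow_mul (√(1 - t)), Real.sq_sqrt h0.le]
      ring
    have hg : t ^ (3 / 2 : ℝ) * (1 - t) ^ (-(1 / 2) : ℝ) *
        (Real.exp (-z * (1 + Real.sqrt (1 - t))) + Real.exp (-z * (1 - Real.sqrt (1 - t)))) =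
        2 * Real.exp (-z) * (t ^ (3 / 2 : ℝ) * (1 - t) ^ (-(1 / 2) : ℝ)) *
          Real.cosh (z * √(1 - t)) := by
      have e1 : -z * (1 + √(1 - t)) = -z + -(z * √(1 - t)) := by ring
      have e2 : -z * (1 - √(1 - t)) = -z + z * √(1 - t) := by ring
      rw [e1, e2, Real.exp_add, Real.exp_add, Real.cosh_eq]
      ring
    simp only [hf, hg]
    exact hc

/-- For `ρ > 0`,
`K_L(ρ) = ∫₀¹ t^{3/2} (1−t)^{−1/2} [e^{−2πρ(1+√(1−t))} + e^{−2πρ(1−√(1−t))}] dt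
        = (3/(2π)) ρ^{−2} e^{−2πρ} I₂(2πρ)`. -/
theorem K_length_integral (ρ : ℝ) (hρ : 0 < ρ) :
    ∫ t in (0 : ℝ)..1, t ^ (3 / 2 : ℝ) * (1 - t) ^ (-(1 / 2) : ℝ) *
        (Real.exp (-(2 * π * ρ) * (1 + Real.sqrt (1 - t)))
          + Real.exp (-(2 * π * ρ) * (1 - Real.sqrt (1 - t))))
      = 3 / (2 * π) * ρ⁻¹ ^ 2 * Real.exp (-(2 * π * ρ)) * besselI2 (2 * π * ρ) := by
  have hz : 0 < 2 * π * ρ := by positivity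
  rw [← (aux_main (2 * π * ρ) hz).tsum_eq, besselI2, ← tsum_mul_left]
  congr 1
  funext n
  have h4 : (4 : ℝ) ^ n = 2 ^ (2 * n) := by rw [pow_mul]; norm_num
  rw [aux_coef, h4, div_pow, pow_add (2 * π * ρ), pow_add (2 : ℝ)]
  generalize Real.exp (-(2 * π * ρ)) = E
  have hw : (2 * π * ρ) ^ (2 * n) ≠ 0 := by positivity
  generalize (2 * π * ρ) ^ (2 * n) = w at *
  field_simp
  try ring
end
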